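/- arXiv:1202.1967 — 2 statements merged into one kernel-verified Lean document; each statement's English description precedes it below -/
import Mathlib

section
/- (Lemma 5.3, arithmetic form: the inner dyadic summation over modulation variables.) Let b₁,b₂,b₃ ∈ ℝ satisfy b_j + b_k > 0 for all j ≠ k and b₁+b₂+b₃ > 1/2, and let ε > 0. Then there exists a constant C (depending on b₁,b₂,b₃,ε) such that for all dyadic numbers N₁,N₂,N₃: Σ L₁^{-b₁} L₂^{-b₂} L₃^{-b₃} · min{ (N_min·L_min)^{1/2}, (L₁·L₃)^{1/2}, (L₂·L₃)^{1/2} } ≤ C · N₃^{ε} · ( N₃^{1/2-b₁-b₂-b₃} N_min^{1/2} + N₃^{-b₃} N_min^{1/2} + N₃^{-b_min} N_min^{(1/2-b_max)₊ + (1/2-b_med)₊} ), where the sum is over all dyadic triples (L₁,L₂,L₃) with max{N₃, L_med}/16 ≤ L_max ≤ 16·max{N₃, L_med}. Here N_min = min{N₁,N₂,N₃}; L_min, L_med, L_max are the minimum, median, maximum of {L₁,L₂,L₃}; b_min, b_med, b_max are the minimum, median, maximum of {b₁,b₂,b₃}; and a₊ = max(a,0). -/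
open scoped Classical

/-- The summand of the inner dyadic modulation sum: for dyadic
`L₁, L₂, L₃` (and dyadic `N₁, N₂, N₃`), the quantity
`L₁^{-b₁} L₂^{-b₂} L₃^{-b₃} · min{(N_min L_min)^{1/2}, (L₁L₃)^{1/2}, (L₂L₃)^{1/2}}`,
restricted by the constraint `max{N₃, L_med}/16 ≤ L_max ≤ 16·max{N₃, L_med}`. -/
noncomputable def innerSummand (b₁ b₂ b₃ N₁ N₂ N₃ L₁ L₂ L₃ : ℝ) : ENNReal :=
  if max N₃ (L₁ + L₂ + L₃ - max L₁ (max L₂ L₃) - min L₁ (min L₂ L₃)) / 16 ≤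
        max L₁ (max L₂ L₃) ∧
      max L₁ (max L₂ L₃) ≤
        16 * max N₃ (L₁ + L₂ + L₃ - max L₁ (max L₂ L₃) - min L₁ (min L₂ L₃)) then
    ENNReal.ofReal
      (L₁ ^ (-b₁) * L₂ ^ (-b₂) * L₃ ^ (-b₃) *
        min (Real.sqrt (min N₁ (min N₂ N₃) * min L₁ (min L₂ L₃)))
          (min (Real.sqrt (L₁ * L₃)) (Real.sqrt (L₂ * L₃))))
  else 0

/-- The upper bounds at the corners of `0 ≤ x, y ≤ m` for the exponent
`-a n - b x - c y + (x + y) / 2`. -/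
def CornerBounds (a b c n m M : ℝ) : Prop :=
  -a * n ≤ M ∧ -a * n + (1 / 2 - b) * m ≤ M ∧ -a * n + (1 / 2 - c) * m ≤ M ∧
    -a * n + (1 - b - c) * m ≤ M

theorem CornerBounds.swap {a b c n m M : ℝ} (h : CornerBounds a b c n m M) :
    CornerBounds a c b n m M := by
  obtain ⟨h1, h2, h3, h4⟩ := h
  exact ⟨h1, h3, h2, by linarith⟩

theorem cornerBounds_of_min {a b c n m M : ℝ} (hm : 0 ≤ m)
    (h : -a * n + m * (max (1 / 2 - b) 0 + max (1 / 2 - c) 0) ≤ M) :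
    CornerBounds a b c n m M := by
  have e1 := mul_le_mul_of_nonneg_left (le_max_left (1 / 2 - b) 0) hm
  have e2 := mul_le_mul_of_nonneg_left (le_max_right (1 / 2 - b) 0) hm
  have e3 := mul_le_mul_of_nonneg_left (le_max_left (1 / 2 - c) 0) hm
  have e4 := mul_le_mul_of_nonneg_left (le_max_right (1 / 2 - c) 0) hm
  refine ⟨?_, ?_, ?_, ?_⟩ <;> linarith

theorem cornerBounds_of_min_snd {a b c n m M : ℝ} (hm : 0 ≤ m) (hmn : m ≤ n) (hba : b ≤ a)
    (h : -b * n + m * (max (1 / 2 - a) 0 + max (1 / 2 - c) 0) ≤ M) :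
    CornerBounds a b c n m M := by
  have e1 := mul_le_mul_of_nonneg_left (le_max_left (1 / 2 - a) 0) hm
  have e2 := mul_le_mul_of_nonneg_left (le_max_right (1 / 2 - a) 0) hm
  have e3 := mul_le_mul_of_nonneg_left (le_max_left (1 / 2 - c) 0) hm
  have e4 := mul_le_mul_of_nonneg_left (le_max_right (1 / 2 - c) 0) hm
  have e5 := mul_nonneg (sub_nonneg.2 hba) (sub_nonneg.2 hmn)
  have e6 := mul_nonneg (sub_nonneg.2 hba) hm
  refine ⟨?_, ?_, ?_, ?_⟩ <;> linarith

theorem CornerBounds.pair_bound {a b c n m M : ℝ} (h : CornerBounds a b c n m M)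
    (h' : CornerBounds c a b n m M) (hmn : m ≤ n) (hac : 0 < a + c) :
    -(a + c) * n + m / 2 ≤ M := by
  obtain ⟨-, -, h3, -⟩ := h
  obtain ⟨-, h2, -, -⟩ := h'
  rcases le_total 0 c with hc | hc
  · linarith [mul_le_mul_of_nonneg_left hmn hc]
  · linarith [mul_le_mul_of_nonneg_left hmn (by linarith : 0 ≤ a)]

theorem affine_le_of_corners {K α c t n x y M : ℝ} (hx : 0 ≤ x) (hxy : x ≤ y) (hty : t ≤ y)
    (hyn : y ≤ n) (h1 : K - c * t ≤ M) (h2 : K + α * t - c * t ≤ M) (h3 : K - c * n ≤ M)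
    (h4 : K + α * n - c * n ≤ M) : K + α * x - c * y ≤ M := by
  rcases le_total α 0 with hα | hα
  · have e := mul_nonpos_of_nonpos_of_nonneg hα hx
    rcases le_total c 0 with hc | hc
    · linarith [mul_le_mul_of_nonpos_left hyn hc]
    · linarith [mul_le_mul_of_nonneg_left hty hc]
  · have e := mul_le_mul_of_nonneg_left hxy hα
    rcases le_total (α - c) 0 with hc | hc
    · linarith [mul_le_mul_of_nonpos_left hty hc]
    · linarith [mul_le_mul_of_nonneg_left hyn hc]

theorem exponent_le_of_far {a b c n m M δ x y : ℝ} (hx : 0 ≤ x) (hxy : x ≤ y) (hny : n ≤ y)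
    (hac : δ ≤ a + c) (hs : δ ≤ a + b + c - 1 / 2) (hw : -(a + c) * n + m / 2 ≤ M)
    (hv : (1 / 2 - a - b - c) * n + m / 2 ≤ M) :
    -a * y - b * x - c * y + (m + x) / 2 ≤ M - δ * (y - n) := by
  have hyn := sub_nonneg.2 hny
  rcases le_total (1 / 2 - b) 0 with hb | hb
  · linarith [mul_nonpos_of_nonpos_of_nonneg hb hx, mul_le_mul_of_nonneg_right hac hyn]
  · linarith [mul_le_mul_of_nonneg_left hxy hb, mul_le_mul_of_nonneg_right hs hyn]

theorem exponent_le {a b c n m M δ x y : ℝ} (hx : 0 ≤ x) (hxy : x ≤ y)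
    (hac : δ ≤ a + c) (hs : δ ≤ a + b + c - 1 / 2) (hw : -(a + c) * n + m / 2 ≤ M)
    (hv : (1 / 2 - a - b - c) * n + m / 2 ≤ M) (h0 : -a * n + m / 2 ≤ M) :
    -a * max n y - b * x - c * y + (m + x) / 2 ≤ M - δ * (max n y - n) := by
  rcases le_total n y with h | h
  · rw [max_eq_right h]
    exact exponent_le_of_far hx hxy h hac hs hw hv
  · rw [max_eq_left h]
    have := affine_le_of_corners (K := -a * n + m / 2) (α := 1 / 2 - b) (c := c) (t := 0)
      (M := M) hx hxy (hx.trans hxy) h (by linarith) (by linarith) (by linarith) (by linarith)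
    linarith

theorem exponent_le_of_cornerBounds {a b c n m M δ x y : ℝ} (hx : 0 ≤ x) (hxy : x ≤ y)
    (hac : δ ≤ a + c) (hs : δ ≤ a + b + c - 1 / 2)
    (hw : -(a + c) * n + m / 2 ≤ M) (hv : (1 / 2 - a - b - c) * n + m / 2 ≤ M)
    (hcor : CornerBounds a b c n m M) :
    -a * max n y - b * x - c * y + min ((m + x) / 2) ((x + y) / 2) ≤
      M - δ * (max n y - n) := by
  obtain ⟨h1, -, h3, h4⟩ := hcor
  rcases le_total n y with h | h
  · rw [max_eq_right h]
    linarith [exponent_le_of_far hx hxy h hac hs hw hv, min_le_left ((m + x) / 2) ((x + y) / 2)]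
  · rw [max_eq_left h]
    rcases le_total y m with hym | hym
    · have := affine_le_of_corners (K := -a * n) (α := 1 / 2 - b) (c := c - 1 / 2) (t := 0)
        (M := M) hx hxy (hx.trans hxy) hym (by linarith) (by linarith) (by linarith) (by linarith)
      linarith [min_le_right ((m + x) / 2) ((x + y) / 2)]
    · have := affine_le_of_corners (K := -a * n + m / 2) (α := 1 / 2 - b) (c := c) (t := m)
        (M := M) hx hxy hym h (by linarith) (by linarith) (by linarith) (by linarith)
      linarith [min_le_left ((m + x) / 2) ((x + y) / 2)]

theorem exponent_le_of_near_max {a n δ x y l S R : ℝ} (hδ : 0 ≤ δ) (h1 : max n y ≤ l + 4)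
    (h2 : l ≤ max n y + 4) (hxy : x ≤ y) (hyl : y ≤ l) {D : ℝ} (hD : |a| ≤ D)
    (h : -a * max n y + S ≤ R - δ * (max n y - n)) :
    -a * l + S ≤ R + (4 * D + 4 * δ) + δ * n - δ / 3 * (l + y + x) := by
  have e1 : a * (max n y - l) ≤ |a| * 4 := by
    refine (le_abs_self _).trans ?_
    rw [abs_mul]
    exact mul_le_mul_of_nonneg_left (abs_le.2 ⟨by linarith, by linarith⟩) (abs_nonneg a)
  have e2 := mul_le_mul_of_nonneg_left h2 hδ
  have e3 := mul_le_mul_of_nonneg_left (by linarith : y + x ≤ 2 * l) hδ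
  linarith

theorem near_of_pow_bounds {n y l : ℕ}
    (h : max ((2 : ℝ) ^ n) ((2 : ℝ) ^ y) / 16 ≤ (2 : ℝ) ^ l ∧
      (2 : ℝ) ^ l ≤ 16 * max ((2 : ℝ) ^ n) ((2 : ℝ) ^ y)) :
    max (n : ℝ) y ≤ l + 4 ∧ (l : ℝ) ≤ max (n : ℝ) y + 4 := by
  have hmax : max ((2 : ℝ) ^ n) ((2 : ℝ) ^ y) = 2 ^ max n y :=
    ((pow_right_mono₀ (one_le_two : (1 : ℝ) ≤ 2)).map_max).symm
  rw [hmax] at h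
  have h1 : (2 : ℝ) ^ max n y ≤ 2 ^ (l + 4) := by rw [pow_add]; linarith [h.1]
  have h2 : (2 : ℝ) ^ l ≤ 2 ^ (max n y + 4) := by rw [pow_add]; linarith [h.2]
  rw [pow_le_pow_iff_right₀ one_lt_two] at h1 h2
  exact ⟨by exact_mod_cast h1, by exact_mod_cast h2⟩

theorem sqrt_two_pow_mul (p q : ℕ) :
    Real.sqrt ((2 : ℝ) ^ p * 2 ^ q) = (2 : ℝ) ^ (((p : ℝ) + q) / 2) := by
  rw [← pow_add, Real.sqrt_eq_rpow, ← Real.rpow_natCast, ← Real.rpow_mul zero_le_two]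
  push_cast
  ring_nf

theorem min_two_pow (p q r : ℕ) :
    min ((2 : ℝ) ^ p) (min ((2 : ℝ) ^ q) ((2 : ℝ) ^ r)) = 2 ^ min p (min q r) := by
  have h := pow_right_mono₀ (one_le_two : (1 : ℝ) ≤ 2)
  rw [h.map_min, h.map_min]

theorem two_pow_rpow (p : ℕ) (s : ℝ) : ((2 : ℝ) ^ p) ^ s = (2 : ℝ) ^ ((p : ℝ) * s) := by
  rw [Real.rpow_mul zero_le_two, Real.rpow_natCast]

/-- The constraint `max{N₃, L_med}/16 ≤ L_max ≤ 16·max{N₃, L_med}`. -/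
def ModulationConstraint (N₃ L₁ L₂ L₃ : ℝ) : Prop :=
  max N₃ (L₁ + L₂ + L₃ - max L₁ (max L₂ L₃) - min L₁ (min L₂ L₃)) / 16 ≤
      max L₁ (max L₂ L₃) ∧
    max L₁ (max L₂ L₃) ≤
      16 * max N₃ (L₁ + L₂ + L₃ - max L₁ (max L₂ L₃) - min L₁ (min L₂ L₃))

theorem ModulationConstraint.rotate {N₃ L₁ L₂ L₃ : ℝ}
    (h : ModulationConstraint N₃ L₁ L₂ L₃) : ModulationConstraint N₃ L₂ L₃ L₁ := by
  unfold ModulationConstraint at *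
  rw [← max_assoc L₂, max_comm _ L₁, ← min_assoc L₂, min_comm _ L₁,
    show L₂ + L₃ + L₁ = L₁ + L₂ + L₃ by ring]
  exact h

theorem ModulationConstraint.swap {N₃ L₁ L₂ L₃ : ℝ}
    (h : ModulationConstraint N₃ L₁ L₂ L₃) : ModulationConstraint N₃ L₁ L₃ L₂ := by
  unfold ModulationConstraint at *
  rw [max_comm L₃, min_comm L₃, show L₁ + L₃ + L₂ = L₁ + L₂ + L₃ by ring]
  exact h

theorem ModulationConstraint.near {n l y x : ℕ}
    (h : ModulationConstraint ((2 : ℝ) ^ n) ((2 : ℝ) ^ l) ((2 : ℝ) ^ y) ((2 : ℝ) ^ x))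
    (hxy : x ≤ y) (hyl : y ≤ l) :
    max (n : ℝ) y ≤ l + 4 ∧ (l : ℝ) ≤ max (n : ℝ) y + 4 := by
  have e1 : (2 : ℝ) ^ x ≤ 2 ^ y := pow_le_pow_right₀ one_le_two hxy
  have e2 : (2 : ℝ) ^ y ≤ 2 ^ l := pow_le_pow_right₀ one_le_two hyl
  refine near_of_pow_bounds ?_
  unfold ModulationConstraint at h
  rw [max_eq_left e1, max_eq_left e2, min_eq_right e1, min_eq_right (e1.trans e2),
    show (2 : ℝ) ^ l + 2 ^ y + 2 ^ x - 2 ^ l - 2 ^ x = 2 ^ y by ring] at h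
  exact h

theorem innerSummand_le {b₁ b₂ b₃ R : ℝ} {n₁ n₂ n₃ l₁ l₂ l₃ : ℕ}
    (h : ModulationConstraint ((2 : ℝ) ^ n₃) ((2 : ℝ) ^ l₁) ((2 : ℝ) ^ l₂) ((2 : ℝ) ^ l₃) →
      -b₁ * l₁ - b₂ * l₂ - b₃ * l₃ +
        min ((((min n₁ (min n₂ n₃) : ℕ) : ℝ) + (min l₁ (min l₂ l₃) : ℕ)) / 2)
          (min (((l₁ : ℝ) + l₃) / 2) (((l₂ : ℝ) + l₃) / 2)) ≤ R) :
    innerSummand b₁ b₂ b₃ ((2 : ℝ) ^ n₁) ((2 : ℝ) ^ n₂) ((2 : ℝ) ^ n₃)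
      ((2 : ℝ) ^ l₁) ((2 : ℝ) ^ l₂) ((2 : ℝ) ^ l₃) ≤ ENNReal.ofReal ((2 : ℝ) ^ R) := by
  unfold innerSummand
  split_ifs with hc
  · refine ENNReal.ofReal_le_ofReal ?_
    have hmono : Monotone fun s : ℝ => (2 : ℝ) ^ s :=
      fun _ _ hst => Real.rpow_le_rpow_of_exponent_le one_le_two hst
    rw [min_two_pow, min_two_pow, sqrt_two_pow_mul, sqrt_two_pow_mul, sqrt_two_pow_mul,
      two_pow_rpow, two_pow_rpow, two_pow_rpow, ← hmono.map_min, ← hmono.map_min,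
      ← Real.rpow_add two_pos, ← Real.rpow_add two_pos, ← Real.rpow_add two_pos]
    exact hmono (le_trans (le_of_eq (by ring)) (h hc))
  · exact bot_le

theorem tsum_geometric_triple {r : ℝ} (h0 : 0 ≤ r) (h1 : r < 1) {A : ℝ} (hA : 0 ≤ A) :
    (∑' l₁ : ℕ, ∑' l₂ : ℕ, ∑' l₃ : ℕ, ENNReal.ofReal (A * r ^ l₁ * r ^ l₂ * r ^ l₃)) =
      ENNReal.ofReal (A * ((1 - r)⁻¹) ^ 3) := by
  have hg : ∑' l : ℕ, ENNReal.ofReal (r ^ l) = ENNReal.ofReal (1 - r)⁻¹ := by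
    rw [← ENNReal.ofReal_tsum_of_nonneg (fun l => pow_nonneg h0 l)
      (summable_geometric_of_lt_one h0 h1), tsum_geometric_of_lt_one h0 h1]
  have hG : 0 ≤ (1 - r)⁻¹ := inv_nonneg.2 (by linarith)
  have hterm : ∀ l₁ l₂ l₃ : ℕ, ENNReal.ofReal (A * r ^ l₁ * r ^ l₂ * r ^ l₃) =
      ENNReal.ofReal A * ENNReal.ofReal (r ^ l₁) * ENNReal.ofReal (r ^ l₂) *
        ENNReal.ofReal (r ^ l₃) := by
    intro l₁ l₂ l₃
    rw [ENNReal.ofReal_mul (by positivity), ENNReal.ofReal_mul (by positivity),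
      ENNReal.ofReal_mul hA]
  simp_rw [hterm, ENNReal.tsum_mul_left, hg, ENNReal.tsum_mul_right, ENNReal.tsum_mul_left, ENNReal.tsum_mul_right,
    ENNReal.tsum_mul_left, hg]
  rw [ENNReal.ofReal_mul hA, ENNReal.ofReal_pow hG]
  ring

theorem cornerBounds_triple {b₁ b₂ b₃ n m M : ℝ} (hm : 0 ≤ m) (hmn : m ≤ n)
    {bmin bmed bmax : ℝ}
    (hbmin : bmin = min b₁ (min b₂ b₃)) (hbmax : bmax = max b₁ (max b₂ b₃))
    (hbmed : bmed = b₁ + b₂ + b₃ - bmin - bmax)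
    (h : n * -bmin + m * (max (1 / 2 - bmax) 0 + max (1 / 2 - bmed) 0) ≤ M) :
    CornerBounds b₁ b₂ b₃ n m M ∧ CornerBounds b₂ b₁ b₃ n m M ∧ CornerBounds b₃ b₁ b₂ n m M := by
  have key : ∀ {a b c : ℝ}, a ≤ b → a ≤ c →
      -a * n + m * (max (1 / 2 - b) 0 + max (1 / 2 - c) 0) ≤ M →
      CornerBounds a b c n m M ∧ CornerBounds b a c n m M ∧ CornerBounds c a b n m M :=
    fun hab hac h => ⟨cornerBounds_of_min hm h, cornerBounds_of_min_snd hm hmn hab h,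
      cornerBounds_of_min_snd hm hmn hac (by rwa [add_comm (max _ _)] at h)⟩
  have hsub : ∀ {a b c : ℝ}, a ≤ b → b ≤ c → bmin = a → bmax = c → a + b + c = b₁ + b₂ + b₃ →
      CornerBounds a b c n m M ∧ CornerBounds b a c n m M ∧ CornerBounds c a b n m M := by
    intro a b c hab hbc e1 e2 e3
    have e4 : bmed = b := by linarith
    refine key hab (hab.trans hbc) ?_
    rw [e1, e2, e4] at h
    linarith
  rcases le_total b₁ b₂ with h12 | h12 <;> rcases le_total b₁ b₃ with h13 | h13 <;>
    rcases le_total b₂ b₃ with h23 | h23 <;>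
    simp only [h12, h13, h23, min_eq_left, min_eq_right, max_eq_left, max_eq_right]
      at hbmin hbmax
  · obtain ⟨k1, k2, k3⟩ := hsub h12 h23 hbmin hbmax (by ring)
    exact ⟨k1, k2, k3⟩
  · obtain ⟨k1, k2, k3⟩ := hsub h13 h23 hbmin hbmax (by ring)
    exact ⟨k1.swap, k3, k2⟩
  · obtain ⟨k1, k2, k3⟩ := hsub h12 h23 hbmin (by linarith) (by ring)
    exact ⟨k1, k2, k3⟩
  · obtain ⟨k1, k2, k3⟩ := hsub h13 h12 hbmin hbmax (by ring)
    exact ⟨k2.swap, k3.swap, k1⟩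
  · obtain ⟨k1, k2, k3⟩ := hsub h12 h13 hbmin hbmax (by ring)
    exact ⟨k2, k1, k3.swap⟩
  · obtain ⟨k1, k2, k3⟩ := hsub h12 h13 (by linarith) (by linarith) (by ring)
    exact ⟨k2, k1, k3.swap⟩
  · obtain ⟨k1, k2, k3⟩ := hsub h23 h13 hbmin hbmax (by ring)
    exact ⟨k3, k1.swap, k2.swap⟩
  · obtain ⟨k1, k2, k3⟩ := hsub h23 h12 hbmin hbmax (by ring)
    exact ⟨k3.swap, k2.swap, k1.swap⟩

theorem exponent_le_of_constraint {b₁ b₂ b₃ δ D m M : ℝ} {n l₁ l₂ l₃ : ℕ}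
    (hδ : 0 ≤ δ) (h12 : δ ≤ b₁ + b₂) (h13 : δ ≤ b₁ + b₃) (h23 : δ ≤ b₂ + b₃)
    (hs : δ ≤ b₁ + b₂ + b₃ - 1 / 2)
    (hD₁ : |b₁| ≤ D) (hD₂ : |b₂| ≤ D) (hD₃ : |b₃| ≤ D)
    (hw₁ : -(b₂ + b₃) * n + m / 2 ≤ M) (hw₂ : -(b₁ + b₃) * n + m / 2 ≤ M)
    (hw₃ : -(b₁ + b₂) * n + m / 2 ≤ M)
    (hv : (1 / 2 - b₁ - b₂ - b₃) * n + m / 2 ≤ M) (h0 : -b₃ * n + m / 2 ≤ M)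
    (hc₁ : CornerBounds b₁ b₂ b₃ n m M) (hc₂ : CornerBounds b₂ b₁ b₃ n m M)
    (hl : ModulationConstraint ((2 : ℝ) ^ n) ((2 : ℝ) ^ l₁) ((2 : ℝ) ^ l₂) ((2 : ℝ) ^ l₃)) :
    -b₁ * l₁ - b₂ * l₂ - b₃ * l₃ +
        min ((m + (min l₁ (min l₂ l₃) : ℕ)) / 2)
          (min (((l₁ : ℝ) + l₃) / 2) (((l₂ : ℝ) + l₃) / 2)) ≤
      M + (4 * D + 4 * δ) + δ * n - δ / 3 * (l₁ + l₂ + l₃) := by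
  have hmin : ∀ k : ℕ, min l₁ (min l₂ l₃) ≤ k → ((min l₁ (min l₂ l₃) : ℕ) : ℝ) ≤ k :=
    fun k hk => by exact_mod_cast hk
  set Q := min ((m + (min l₁ (min l₂ l₃) : ℕ)) / 2)
    (min (((l₁ : ℝ) + l₃) / 2) (((l₂ : ℝ) + l₃) / 2))
  have q0 : Q ≤ (m + (min l₁ (min l₂ l₃) : ℕ)) / 2 := min_le_left _ _
  have q1 : Q ≤ (m + l₁) / 2 := by linarith [hmin l₁ (by omega)]
  have q2 : Q ≤ (m + l₂) / 2 := by linarith [hmin l₂ (by omega)]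
  have q3 : Q ≤ (m + l₃) / 2 := by linarith [hmin l₃ (by omega)]
  have q13 : Q ≤ ((l₁ : ℝ) + l₃) / 2 := (min_le_right _ _).trans (min_le_left _ _)
  have q23 : Q ≤ ((l₂ : ℝ) + l₃) / 2 := (min_le_right _ _).trans (min_le_right _ _)
  have corner_case : ∀ {a b c : ℝ} {l x y : ℕ}, x ≤ y → y ≤ l →
      ModulationConstraint ((2 : ℝ) ^ n) ((2 : ℝ) ^ l) ((2 : ℝ) ^ y) ((2 : ℝ) ^ x) →
      |a| ≤ D → δ ≤ a + c → δ ≤ a + b + c - 1 / 2 → -(a + c) * n + m / 2 ≤ M →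
      (1 / 2 - a - b - c) * n + m / 2 ≤ M → CornerBounds a b c n m M →
      Q ≤ (m + x) / 2 → Q ≤ ((x : ℝ) + y) / 2 →
      -a * l + (-b * x - c * y + Q) ≤
        M + (4 * D + 4 * δ) + δ * n - δ / 3 * (l + y + x) := by
    intro a b c l x y hxy hyl hc hD hac hS hw hV hcor h1 h2
    obtain ⟨k1, k2⟩ := hc.near hxy hyl
    refine exponent_le_of_near_max hδ k1 k2 (by exact_mod_cast hxy) (by exact_mod_cast hyl) hD ?_
    linarith [exponent_le_of_cornerBounds (Nat.cast_nonneg x) (Nat.cast_le.2 hxy) hac hS hw hV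
      hcor, le_min h1 h2]
  have top_case : ∀ {a b c : ℝ} {l x y : ℕ}, x ≤ y → y ≤ l →
      ModulationConstraint ((2 : ℝ) ^ n) ((2 : ℝ) ^ l) ((2 : ℝ) ^ y) ((2 : ℝ) ^ x) →
      |a| ≤ D → δ ≤ a + c → δ ≤ a + b + c - 1 / 2 → -(a + c) * n + m / 2 ≤ M →
      (1 / 2 - a - b - c) * n + m / 2 ≤ M → -a * n + m / 2 ≤ M →
      Q ≤ (m + x) / 2 →
      -a * l + (-b * x - c * y + Q) ≤
        M + (4 * D + 4 * δ) + δ * n - δ / 3 * (l + y + x) := by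
    intro a b c l x y hxy hyl hc hD hac hS hw hV hcor h1
    obtain ⟨k1, k2⟩ := hc.near hxy hyl
    refine exponent_le_of_near_max hδ k1 k2 (by exact_mod_cast hxy) (by exact_mod_cast hyl) hD ?_
    linarith [exponent_le (Nat.cast_nonneg x) (Nat.cast_le.2 hxy) hac hS hw hV hcor]
  rcases le_total l₁ l₂ with k12 | k12 <;> rcases le_total l₁ l₃ with k13 | k13 <;>
    rcases le_total l₂ l₃ with k23 | k23
  · linarith [top_case k12 k23 hl.rotate.rotate.swap hD₃ (by linarith) (by linarith)
      (by linarith) (by linarith) h0 q1 (b := b₁) (c := b₂)]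
  · linarith [corner_case k13 k23 hl.rotate hD₂ h23 (by linarith) (by linarith) (by linarith)
      hc₂ q1 q13]
  · linarith [top_case k12 k23 hl.rotate.rotate.swap hD₃ (by linarith) (by linarith)
      (by linarith) (by linarith) h0 q1 (b := b₁) (c := b₂)]
  · linarith [corner_case k13 k12 hl.rotate.swap hD₂ (by linarith) (by linarith) (by linarith)
      (by linarith) hc₂.swap q3 (by linarith)]
  · linarith [top_case k12 k13 hl.rotate.rotate hD₃ (by linarith) (by linarith)
      (by linarith) (by linarith) h0 q2 (b := b₂) (c := b₁)]
  · linarith [corner_case k23 k12 hl hD₁ h12 (by linarith) (by linarith)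
      (by linarith) hc₁.swap q3 (by linarith)]
  · linarith [corner_case k23 k13 hl.swap hD₁ h13 (by linarith) (by linarith) (by linarith)
      hc₁ q2 q23]
  · linarith [corner_case k23 k12 hl hD₁ h12 (by linarith) (by linarith) (by linarith)
      hc₁.swap q3 (by linarith)]

theorem two_rpow_max_le (s t u : ℝ) :
    (2 : ℝ) ^ max s (max t u) ≤ 2 ^ s + 2 ^ t + 2 ^ u := by
  have hs := Real.rpow_pos_of_pos two_pos s
  have ht := Real.rpow_pos_of_pos two_pos t
  have hu := Real.rpow_pos_of_pos two_pos u
  rcases max_choice s (max t u) with h | h <;> rw [h]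
  · linarith
  · rcases max_choice t u with h | h <;> rw [h] <;> linarith

theorem inner_dyadic_summation (b₁ b₂ b₃ ε : ℝ)
    (bmin bmed bmax : ℝ)
    (hbmin : bmin = min b₁ (min b₂ b₃)) (hbmax : bmax = max b₁ (max b₂ b₃))
    (hbmed : bmed = b₁ + b₂ + b₃ - bmin - bmax)
    (hb12 : b₁ + b₂ > 0) (hb13 : b₁ + b₃ > 0) (hb23 : b₂ + b₃ > 0)
    (hbsum : b₁ + b₂ + b₃ > 1 / 2) (hε : 0 < ε) :
    ∃ C > (0 : ℝ), ∀ n₁ n₂ n₃ : ℕ,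
      (∑' l₁ : ℕ, ∑' l₂ : ℕ, ∑' l₃ : ℕ,
          innerSummand b₁ b₂ b₃ ((2 : ℝ) ^ n₁) ((2 : ℝ) ^ n₂) ((2 : ℝ) ^ n₃)
            ((2 : ℝ) ^ l₁) ((2 : ℝ) ^ l₂) ((2 : ℝ) ^ l₃))
        ≤ ENNReal.ofReal
            (C * ((2 : ℝ) ^ n₃) ^ ε *
              (((2 : ℝ) ^ n₃) ^ (1 / 2 - b₁ - b₂ - b₃) *
                  (min ((2 : ℝ) ^ n₁) (min ((2 : ℝ) ^ n₂) ((2 : ℝ) ^ n₃))) ^ ((1 : ℝ) / 2) +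
                ((2 : ℝ) ^ n₃) ^ (-b₃) *
                  (min ((2 : ℝ) ^ n₁) (min ((2 : ℝ) ^ n₂) ((2 : ℝ) ^ n₃))) ^ ((1 : ℝ) / 2) +
                ((2 : ℝ) ^ n₃) ^ (-bmin) *
                  (min ((2 : ℝ) ^ n₁) (min ((2 : ℝ) ^ n₂) ((2 : ℝ) ^ n₃))) ^
                    (max (1 / 2 - bmax) 0 + max (1 / 2 - bmed) 0))) := by
  obtain ⟨δ, hδ, hδε, h12, h13, h23, hs⟩ : ∃ δ : ℝ, 0 < δ ∧ δ ≤ ε ∧ δ ≤ b₁ + b₂ ∧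
      δ ≤ b₁ + b₃ ∧ δ ≤ b₂ + b₃ ∧ δ ≤ b₁ + b₂ + b₃ - 1 / 2 := by
    refine ⟨min ε (min (b₁ + b₂) (min (b₁ + b₃) (min (b₂ + b₃) (b₁ + b₂ + b₃ - 1 / 2)))),
      ?_, ?_, ?_, ?_, ?_, ?_⟩
    · simp only [lt_min_iff]
      exact ⟨hε, hb12, hb13, hb23, by linarith⟩
    all_goals simp only [min_le_iff, le_refl, true_or, or_true]
  obtain ⟨D, hD₁, hD₂, hD₃⟩ : ∃ D : ℝ, |b₁| ≤ D ∧ |b₂| ≤ D ∧ |b₃| ≤ D :=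
    ⟨max |b₁| (max |b₂| |b₃|), by simp, by simp, by simp⟩
  set r : ℝ := (2 : ℝ) ^ (-(δ / 3)) with hr
  have hr0 : 0 < r := Real.rpow_pos_of_pos two_pos _
  have hr1 : r < 1 := Real.rpow_lt_one_of_one_lt_of_neg one_lt_two (by linarith)
  have hG : 0 < (1 - r)⁻¹ := inv_pos.2 (by linarith)
  refine ⟨(2 : ℝ) ^ (4 * D + 4 * δ) * ((1 - r)⁻¹) ^ 3, by positivity, fun n₁ n₂ n₃ => ?_⟩
  set m : ℕ := min n₁ (min n₂ n₃) with hm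
  set P : ℝ := max (1 / 2 - bmax) 0 + max (1 / 2 - bmed) 0
  rw [min_two_pow, ← hm]
  simp only [two_pow_rpow, ← Real.rpow_add two_pos]
  set M : ℝ := max ((n₃ : ℝ) * (1 / 2 - b₁ - b₂ - b₃) + m * (1 / 2))
    (max ((n₃ : ℝ) * -b₃ + m * (1 / 2)) ((n₃ : ℝ) * -bmin + m * P))
  have hmn : (m : ℝ) ≤ n₃ := by exact_mod_cast (by omega : m ≤ n₃)
  have hM₁ : (n₃ : ℝ) * (1 / 2 - b₁ - b₂ - b₃) + m * (1 / 2) ≤ M := le_max_left _ _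
  have hM₂ : (n₃ : ℝ) * -b₃ + m * (1 / 2) ≤ M := (le_max_left _ _).trans (le_max_right _ _)
  have hM₃ : (n₃ : ℝ) * -bmin + m * P ≤ M := (le_max_right _ _).trans (le_max_right _ _)
  obtain ⟨hc₁, hc₂, hc₃⟩ := cornerBounds_triple (Nat.cast_nonneg m) hmn hbmin hbmax hbmed hM₃
  have hw₁ := hc₂.pair_bound hc₃.swap hmn hb23
  have hw₂ := hc₁.pair_bound hc₃ hmn hb13
  have hw₃ := hc₁.swap.pair_bound hc₂ hmn hb12
  have hterm : ∀ l₁ l₂ l₃ : ℕ,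
      innerSummand b₁ b₂ b₃ ((2 : ℝ) ^ n₁) ((2 : ℝ) ^ n₂) ((2 : ℝ) ^ n₃)
        ((2 : ℝ) ^ l₁) ((2 : ℝ) ^ l₂) ((2 : ℝ) ^ l₃) ≤
      ENNReal.ofReal ((2 : ℝ) ^ (M + (4 * D + 4 * δ) + δ * n₃) * r ^ l₁ * r ^ l₂ * r ^ l₃) := by
    intro l₁ l₂ l₃
    refine (innerSummand_le fun hl => exponent_le_of_constraint hδ.le h12 h13 h23 hs hD₁ hD₂
      hD₃ hw₁ hw₂ hw₃ (by linarith) (by linarith) hc₁ hc₂ hl).trans (le_of_eq ?_)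
    rw [hr, ← Real.rpow_mul_natCast zero_le_two, ← Real.rpow_mul_natCast zero_le_two,
      ← Real.rpow_mul_natCast zero_le_two, ← Real.rpow_add two_pos, ← Real.rpow_add two_pos,
      ← Real.rpow_add two_pos]
    ring_nf
  refine (ENNReal.tsum_le_tsum fun l₁ => ENNReal.tsum_le_tsum fun l₂ =>
    ENNReal.tsum_le_tsum fun l₃ => hterm l₁ l₂ l₃).trans ?_
  rw [tsum_geometric_triple hr0.le hr1 (by positivity)]
  refine ENNReal.ofReal_le_ofReal ?_
  have hε' : (2 : ℝ) ^ (δ * n₃) ≤ 2 ^ ((n₃ : ℝ) * ε) :=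
    Real.rpow_le_rpow_of_exponent_le one_le_two
      (by linarith [mul_le_mul_of_nonneg_right hδε (Nat.cast_nonneg (α := ℝ) n₃)])
  rw [Real.rpow_add two_pos, Real.rpow_add two_pos]
  calc (2 : ℝ) ^ M * 2 ^ (4 * D + 4 * δ) * 2 ^ (δ * n₃) * (1 - r)⁻¹ ^ 3
      = 2 ^ (4 * D + 4 * δ) * (1 - r)⁻¹ ^ 3 * 2 ^ (δ * n₃) * 2 ^ M := by ring
    _ ≤ _ := by
      gcongr
      exact two_rpow_max_le _ _ _
end

section
/- (Inequality (5.5) from the proof of Lemma 5.3.) Let b₁,b₂,b₃ ∈ ℝ satisfy b_j + b_k > 0 for all j ≠ k, and let x, y be real numbers with 1 ≤ x ≤ y. Then x^{1/2} · y^{(1/2-b_max)₊ - b_med - b_min} ≤ x^{1/2} · y^{1/2 - b₁ - b₂ - b₃} + x^{(1/2-b_max)₊ + (1/2-b_med)₊} · y^{-b_min}, where b_min, b_med, b_max denote the minimum, median and maximum of {b₁,b₂,b₃} and a₊ = max(a,0). -/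
theorem inequality_5_5 (b₁ b₂ b₃ : ℝ)
    (bmin bmed bmax : ℝ)
    (hbmin : bmin = min b₁ (min b₂ b₃)) (hbmax : bmax = max b₁ (max b₂ b₃))
    (hbmed : bmed = b₁ + b₂ + b₃ - bmin - bmax)
    (hb12 : b₁ + b₂ > 0) (hb13 : b₁ + b₃ > 0) (hb23 : b₂ + b₃ > 0)
    (x y : ℝ) (hx : 1 ≤ x) (hxy : x ≤ y) :
    x ^ ((1 : ℝ) / 2) * y ^ (max (1 / 2 - bmax) 0 - bmed - bmin) ≤
      x ^ ((1 : ℝ) / 2) * y ^ (1 / 2 - b₁ - b₂ - b₃) +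
        x ^ (max (1 / 2 - bmax) 0 + max (1 / 2 - bmed) 0) * y ^ (-bmin) := by
  have hx0 : 0 < x := by linarith
  have hy0 : 0 < y := by linarith
  have hmed : 0 ≤ bmed := by grind
  rcases le_total bmax (1 / 2) with h | h
  · have he : max (1 / 2 - bmax) 0 - bmed - bmin = 1 / 2 - b₁ - b₂ - b₃ := by
      rw [max_eq_left (by linarith)]
      linarith
    rw [he]
    exact le_add_of_nonneg_right (by positivity)
  · rw [max_eq_right (by linarith : 1 / 2 - bmax ≤ 0)]
    refine le_add_of_nonneg_of_le (by positivity) ?_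
    calc x ^ ((1 : ℝ) / 2) * y ^ (0 - bmed - bmin)
        = x ^ ((1 : ℝ) / 2) * y ^ (-bmed) * y ^ (-bmin) := by
          rw [mul_assoc, ← Real.rpow_add hy0]
          ring_nf
      _ ≤ x ^ ((1 : ℝ) / 2) * x ^ (-bmed) * y ^ (-bmin) := by
          gcongr ?_ * ?_ * _
          exact Real.rpow_le_rpow_of_nonpos hx0 hxy (by linarith)
      _ = x ^ (1 / 2 - bmed) * y ^ (-bmin) := by
          rw [← Real.rpow_add hx0, ← sub_eq_add_neg]
      _ ≤ x ^ (0 + max (1 / 2 - bmed) 0) * y ^ (-bmin) := by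
          gcongr
          rw [zero_add]
          exact le_max_left _ _
end
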